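/- Let L be a primitive Gaussian line with α_n = α₀ + nδ. For every rational prime p with p ≡ 1 (mod 4), at least one Gaussian prime lying over p divides some Gaussian integer α_n on L. -/

import Mathlib

namespace GaussianInt

/-- If `r ^ 2 ≡ -1 (mod p)`, some Gaussian prime divides both `p` and `i - r`. -/
theorem exists_prime_dvd_natCast_and_dvd_I_sub {p : ℕ} (hp : p.Prime) {r : ℤ}
    (hr : (p : ℤ) ∣ r ^ 2 + 1) :
    ∃ π : GaussianInt, Prime π ∧ π ∣ (p : GaussianInt) ∧ π ∣ (⟨-r, 1⟩ : GaussianInt) := by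
  have hnot : ¬ IsCoprime (p : GaussianInt) ⟨-r, 1⟩ := by
    intro h
    have hdvd : (p : GaussianInt) ∣ ⟨-r, 1⟩ * ⟨r, 1⟩ := by
      obtain ⟨k, hk⟩ := hr
      refine ⟨⟨-k, 0⟩, ?_⟩
      ext
      · simp
        linarith
      · simp
    obtain ⟨z, hz⟩ := h.dvd_of_dvd_mul_left hdvd
    have him : (1 : ℤ) = p * z.im := by simpa using congrArg Zsqrtd.im hz
    exact (Nat.prime_iff_prime_int.mp hp).not_isUnit (isUnit_of_dvd_one ⟨z.im, him⟩)
  have hp0 : (p : GaussianInt) ≠ 0 := by exact_mod_cast hp.ne_zero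
  obtain ⟨π, hπ, hdvd⟩ := WfDvdMonoid.exists_irreducible_factor
    (a := EuclideanDomain.gcd (p : GaussianInt) ⟨-r, 1⟩)
    (fun hu ↦ hnot (EuclideanDomain.gcd_isUnit_iff.mp hu))
    (fun h0 ↦ hp0 (EuclideanDomain.gcd_eq_zero_iff.mp h0).1)
  exact ⟨π, hπ.prime, hdvd.trans (EuclideanDomain.gcd_dvd_left _ _),
    hdvd.trans (EuclideanDomain.gcd_dvd_right _ _)⟩

theorem exists_prime_dvd_add_intCast_mul {p : ℕ} (hp : p.Prime) {r : ℤ}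
    (hr : (p : ℤ) ∣ r ^ 2 + 1) (α δ : GaussianInt) (hδ : ¬ (p : ℤ) ∣ δ.re + δ.im * r) :
    ∃ π : GaussianInt, Prime π ∧ π ∣ (p : GaussianInt) ∧
      ∃ n : ℤ, π ∣ (α + (n : GaussianInt) * δ) := by
  obtain ⟨π, hπ, hπp, hπr⟩ := exists_prime_dvd_natCast_and_dvd_I_sub hp hr
  obtain ⟨u, v, huv⟩ := (Nat.prime_iff_prime_int.mp hp).coprime_iff_not_dvd.mpr hδ
  refine ⟨π, hπ, hπp, -(α.re + α.im * r) * v, ?_⟩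
  have key : α + ((-(α.re + α.im * r) * v : ℤ) : GaussianInt) * δ =
      p * (((α.re + α.im * r) * u : ℤ) : GaussianInt) +
        ⟨-r, 1⟩ * ((α.im + -(α.re + α.im * r) * v * δ.im : ℤ) : GaussianInt) := by
    ext
    · simp only [Zsqrtd.re_add, Zsqrtd.re_mul, Zsqrtd.re_intCast, Zsqrtd.im_intCast,
        Zsqrtd.re_natCast, Zsqrtd.im_natCast]
      linear_combination -(α.re + α.im * r) * huv
    · simp only [Zsqrtd.im_add, Zsqrtd.im_mul, Zsqrtd.re_intCast, Zsqrtd.im_intCast,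
        Zsqrtd.re_natCast, Zsqrtd.im_natCast]
      ring
  rw [key]
  exact dvd_add (hπp.mul_right _) (hπr.mul_right _)

end GaussianInt

/-- for every rational prime `p ≡ 1 (mod 4)`, some Gaussian prime lying over
`p` divides a Gaussian integer on any given primitive Gaussian line. -/
theorem gaussian_line_prime_over_one_mod_four
    (α₀ δ : GaussianInt) (hcd : Int.gcd δ.re δ.im = 1) (hcop : IsCoprime α₀ δ)
    (p : ℕ) (hp : p.Prime) (hp1 : p % 4 = 1) :
    ∃ π : GaussianInt, Prime π ∧ π ∣ (p : GaussianInt) ∧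
      ∃ n : ℤ, π ∣ (α₀ + (n : GaussianInt) * δ) := by
  have : Fact p.Prime := ⟨hp⟩
  have hpi : Prime (p : ℤ) := Nat.prime_iff_prime_int.mp hp
  obtain ⟨r, hr⟩ : ∃ r : ℤ, (p : ℤ) ∣ r ^ 2 + 1 := by
    obtain ⟨y, hy⟩ := ZMod.exists_sq_eq_neg_one_iff.mpr (show p % 4 ≠ 3 by omega)
    obtain ⟨r, rfl⟩ := ZMod.intCast_surjective y
    refine ⟨r, (ZMod.intCast_zmod_eq_zero_iff_dvd _ p).mp ?_⟩
    push_cast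
    rw [pow_two, ← hy, neg_add_cancel]
  by_cases hplus : (p : ℤ) ∣ δ.re + δ.im * r
  · refine GaussianInt.exists_prime_dvd_add_intCast_mul hp (r := -r) (by simpa using hr) α₀ δ ?_
    intro hminus
    have htwo : ¬ (p : ℤ) ∣ 2 := by
      intro h
      have hle : p ≤ 2 := Nat.le_of_dvd two_pos (by exact_mod_cast h)
      have := hp.two_le
      omega
    have hre : (p : ℤ) ∣ δ.re := by
      refine (hpi.dvd_or_dvd (?_ : (p : ℤ) ∣ 2 * δ.re)).resolve_left htwo
      have hsum : 2 * δ.re = δ.re + δ.im * r + (δ.re + δ.im * -r) := by ring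
      exact hsum ▸ dvd_add hplus hminus
    have hr0 : ¬ (p : ℤ) ∣ r := fun h ↦
      hpi.not_isUnit (isUnit_of_dvd_one ((dvd_add_right (dvd_pow h two_ne_zero)).mp hr))
    have him : (p : ℤ) ∣ δ.im :=
      (hpi.dvd_or_dvd ((dvd_add_right hre).mp hplus)).resolve_right hr0
    have hgcd := Int.dvd_coe_gcd hre him
    rw [hcd] at hgcd
    exact hpi.not_isUnit (isUnit_of_dvd_one (by simpa using hgcd))
  · exact GaussianInt.exists_prime_dvd_add_intCast_mul hp hr α₀ δ hplus
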